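/- Let A be a unital commutative C*-algebra, let d, n be positive natural numbers, let f ≥ 0 be a real number, and let P : A^d → A^d be an A-module map that is idempotent and self-adjoint with respect to the A-valued inner product. Suppose there exist ω_1, …, ω_d ∈ A^d with P ω_k = ω_k for all k, which form a Parseval frame for the range of P (⟨x,x⟩ = ∑_{k=1}^d ⟨x, ω_k⟩⟨ω_k, x⟩ whenever Px = x), have equal inner products ⟨ω_k, ω_k⟩ = (n/d)·1_A for all k, and satisfy ‖∑_{k=1}^d ⟨P e_k − ω_k, P e_k − ω_k⟩‖ ≤ f. Then there exists an A-module map Q : A^d → A^d that is idempotent and self-adjoint, with ⟨Q e_k, Q e_k⟩ = (n/d)·1_A for all 1 ≤ k ≤ d, and ‖∑_{k=1}^d ⟨P e_k − Q e_k, P e_k − Q e_k⟩‖ ≤ 4f. -/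

import Mathlib

open Finset

/-- The `A`-valued inner product on the standard Hilbert `A`-module `A^d`:
`⟨x, y⟩ = ∑ i, x i * (y i)^*`. -/
def modInner {A : Type*} [Ring A] [StarRing A] {d : ℕ} (x y : Fin d → A) : A :=
  ∑ i, x i * star (y i)

/-- The standard basis vector `e_k` of `A^d`. -/
def stdVec (A : Type*) [Ring A] {d : ℕ} (k : Fin d) : Fin d → A :=
  fun i => if i = k then 1 else 0

section ModInner

variable {A : Type*} [CommRing A] [StarRing A] {d : ℕ}

theorem modInner_add_left (x y z : Fin d → A) :
    modInner (x + y) z = modInner x z + modInner y z := by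
  simp [modInner, add_mul, Finset.sum_add_distrib]

theorem modInner_add_right (x y z : Fin d → A) :
    modInner x (y + z) = modInner x y + modInner x z := by
  simp [modInner, mul_add, Finset.sum_add_distrib]

theorem modInner_sub_left (x y z : Fin d → A) :
    modInner (x - y) z = modInner x z - modInner y z := by
  simp [modInner, sub_mul, Finset.sum_sub_distrib]

theorem modInner_sub_right (x y z : Fin d → A) :
    modInner x (y - z) = modInner x y - modInner x z := by
  simp [modInner, mul_sub, Finset.sum_sub_distrib]

theorem modInner_smul_left (a : A) (x y : Fin d → A) :
    modInner (a • x) y = a * modInner x y := by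
  simp [modInner, Finset.mul_sum, mul_assoc]

theorem modInner_smul_right (a : A) (x y : Fin d → A) :
    modInner x (a • y) = star a * modInner x y := by
  simp only [modInner, Finset.mul_sum, Pi.smul_apply, smul_eq_mul, star_mul']
  exact Finset.sum_congr rfl fun _ _ => by ring

theorem star_modInner (x y : Fin d → A) : star (modInner x y) = modInner y x := by
  simp [modInner, star_sum, mul_comm]

theorem modInner_stdVec_right (x : Fin d → A) (k : Fin d) : modInner x (stdVec A k) = x k := by
  simp [modInner, stdVec, apply_ite star]

theorem modInner_stdVec_left (x : Fin d → A) (k : Fin d) :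
    modInner (stdVec A k) x = star (x k) := by
  simp [modInner, stdVec]

/-- The `A`-linear endomorphism of `A^d` whose matrix is the Gram matrix of `ω`. -/
def gramMap (ω : Fin d → Fin d → A) : (Fin d → A) →ₗ[A] (Fin d → A) :=
  (Matrix.of fun k j => modInner (ω k) (ω j)).vecMulLinear

theorem gramMap_apply (ω : Fin d → Fin d → A) (x : Fin d → A) (j : Fin d) :
    gramMap ω x j = ∑ k, x k * modInner (ω k) (ω j) := rfl

theorem gramMap_stdVec (ω : Fin d → Fin d → A) (k j : Fin d) :
    gramMap ω (stdVec A k) j = modInner (ω k) (ω j) := by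
  simp [gramMap_apply, stdVec]

theorem modInner_gramMap (ω : Fin d → Fin d → A) (x y : Fin d → A) :
    modInner (gramMap ω x) y = modInner x (gramMap ω y) := by
  change ∑ j, gramMap ω x j * star (y j) = ∑ j, x j * star (gramMap ω y j)
  simp only [gramMap_apply, star_sum, star_mul', star_modInner, Finset.sum_mul, Finset.mul_sum]
  rw [Finset.sum_comm]
  refine Finset.sum_congr rfl fun i _ => Finset.sum_congr rfl fun j _ => ?_
  ring

theorem gramMap_gramMap (ω : Fin d → Fin d → A)
    (h : ∀ k i, modInner (ω k) (ω i) = ∑ j, modInner (ω k) (ω j) * modInner (ω j) (ω i))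
    (x : Fin d → A) : gramMap ω (gramMap ω x) = gramMap ω x := by
  ext i
  simp only [gramMap_apply, Finset.sum_mul]
  rw [Finset.sum_comm]
  refine Finset.sum_congr rfl fun k _ => ?_
  rw [h k i, Finset.mul_sum]
  exact Finset.sum_congr rfl fun j _ => mul_assoc _ _ _

end ModInner

/-- Polarization of the Parseval identity on a submodule. -/
theorem modInner_eq_sum_of_parseval {A : Type*} [CommCStarAlgebra A] {d : ℕ}
    {ι : Type*} [Fintype ι] (M : Submodule A (Fin d → A)) (ω : ι → Fin d → A)
    (h : ∀ x ∈ M, modInner x x = ∑ k, modInner x (ω k) * star (modInner x (ω k)))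
    {x y : Fin d → A} (hx : x ∈ M) (hy : y ∈ M) :
    modInner x y = ∑ k, modInner x (ω k) * modInner (ω k) y := by
  obtain ⟨i, hi, hs⟩ : ∃ i : A, i * i = -1 ∧ star i = -i :=
    ⟨algebraMap ℂ A Complex.I, by rw [← map_mul, Complex.I_mul_I, map_neg, map_one],
      by rw [← algebraMap_star_comm]; simp⟩
  have h2 : IsUnit (2 : A) := by
    simpa only [map_ofNat] using (IsUnit.mk0 (2 : ℂ) two_ne_zero).map (algebraMap ℂ A)
  have hpol : ∀ y ∈ M, modInner x y + modInner y x
      = ∑ k, modInner x (ω k) * modInner (ω k) y + ∑ k, modInner y (ω k) * modInner (ω k) x := by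
    intro y hy
    have e1 := h x hx
    have e2 := h y hy
    have e3 := h _ (M.add_mem hx hy)
    simp only [modInner_add_left, modInner_add_right, star_add, star_modInner, add_mul, mul_add,
      Finset.sum_add_distrib] at e1 e2 e3
    linear_combination e3 - e1 - e2
  have e1 := hpol y hy
  have e2 := hpol _ (M.smul_mem i hy)
  simp only [modInner_smul_left, modInner_smul_right, hs, mul_left_comm _ (-i), mul_assoc i,
    ← Finset.mul_sum] at e2
  refine h2.mul_left_cancel ?_
  linear_combination e1 + i * e2 + (modInner x y - modInner y x
    - ∑ k, modInner x (ω k) * modInner (ω k) y + ∑ k, modInner y (ω k) * modInner (ω k) x) * hi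

/-- If `τ` and `ω` both satisfy the Parseval identity on the differences `τ k - ω k`, then the sum
of the squared entries of the difference of their Gram matrices is at most
`4 ∑ k, ⟨τ k - ω k, τ k - ω k⟩`. -/
theorem sum_modInner_sub_gram_le {A : Type*} [CommCStarAlgebra A] [PartialOrder A]
    [StarOrderedRing A] {d : ℕ} (τ ω : Fin d → Fin d → A)
    (hτ : ∀ j, ∑ k, modInner (τ k) (τ j - ω j) * star (modInner (τ k) (τ j - ω j))
      = modInner (τ j - ω j) (τ j - ω j))
    (hω : ∀ k, ∑ j, modInner (τ k - ω k) (ω j) * star (modInner (τ k - ω k) (ω j))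
      = modInner (τ k - ω k) (τ k - ω k)) :
    ∑ k, ∑ j, (modInner (τ k) (τ j) - modInner (ω k) (ω j))
        * star (modInner (τ k) (τ j) - modInner (ω k) (ω j))
      ≤ 4 * ∑ k, modInner (τ k - ω k) (τ k - ω k) := by
  set a : Fin d → Fin d → A := fun k j => modInner (τ k) (τ j - ω j)
  set b : Fin d → Fin d → A := fun k j => modInner (τ k - ω k) (ω j)
  have hab : ∀ k j, modInner (τ k) (τ j) - modInner (ω k) (ω j) = a k j + b k j := fun k j => by
    simp only [a, b, modInner_sub_left, modInner_sub_right]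
    ring
  have ha : ∑ k, ∑ j, a k j * star (a k j) = ∑ k, modInner (τ k - ω k) (τ k - ω k) := by
    rw [Finset.sum_comm]
    exact Finset.sum_congr rfl fun j _ => hτ j
  have hb : ∑ k, ∑ j, b k j * star (b k j) = ∑ k, modInner (τ k - ω k) (τ k - ω k) :=
    Finset.sum_congr rfl fun k _ => hω k
  have hpar : ∑ k, ∑ j, (a k j + b k j) * star (a k j + b k j)
      + ∑ k, ∑ j, (a k j - b k j) * star (a k j - b k j)
      = 2 * ∑ k, ∑ j, a k j * star (a k j) + 2 * ∑ k, ∑ j, b k j * star (b k j) := by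
    simp only [Finset.mul_sum, ← Finset.sum_add_distrib]
    refine Finset.sum_congr rfl fun k _ => Finset.sum_congr rfl fun j _ => ?_
    rw [star_add, star_sub]
    ring
  have hnonneg : 0 ≤ ∑ k, ∑ j, (a k j - b k j) * star (a k j - b k j) :=
    Finset.sum_nonneg fun k _ => Finset.sum_nonneg fun j _ => mul_star_self_nonneg _
  simp only [hab]
  calc _ ≤ _ := le_add_of_nonneg_right hnonneg
    _ = _ := by rw [hpar, ha, hb]; ring

/-- Let `A` be a unital commutative C*-algebra, `d, n > 0`, `f ≥ 0`, and let
`P : A^d → A^d` be an idempotent self-adjoint `A`-module map.  Suppose there exist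
`ω_1, …, ω_d` in the range of `P` forming an equal inner product Parseval frame for the
range of `P` with `⟨ω_k, ω_k⟩ = (n/d)·1` and `‖∑ k ⟨P e_k - ω_k, P e_k - ω_k⟩‖ ≤ f`.
Then there is an idempotent self-adjoint `A`-module map `Q : A^d → A^d` with
`⟨Q e_k, Q e_k⟩ = (n/d)·1` for all `k` and `‖∑ k ⟨P e_k - Q e_k, P e_k - Q e_k⟩‖ ≤ 4 f`. -/
theorem modular_paulsen_implies_projection {A : Type*} [CommCStarAlgebra A] [PartialOrder A]
    [StarOrderedRing A] {d n : ℕ} (hd : 0 < d) (hn : 0 < n) (f : ℝ) (hf : 0 ≤ f)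
    (P : (Fin d → A) →ₗ[A] (Fin d → A))
    (hidem : ∀ x, P (P x) = P x)
    (hadj : ∀ x y : Fin d → A, modInner (P x) y = modInner x (P y))
    (hω : ∃ ω : Fin d → Fin d → A,
      (∀ k, P (ω k) = ω k) ∧
      (∀ x : Fin d → A, P x = x →
        modInner x x = ∑ k, modInner x (ω k) * star (modInner x (ω k))) ∧
      (∀ k, modInner (ω k) (ω k) = (((n : ℝ) / (d : ℝ) : ℝ) : ℂ) • (1 : A)) ∧
      ‖∑ k, modInner (P (stdVec A k) - ω k) (P (stdVec A k) - ω k)‖ ≤ f) :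
    ∃ Q : (Fin d → A) →ₗ[A] (Fin d → A),
      (∀ x, Q (Q x) = Q x) ∧
      (∀ x y : Fin d → A, modInner (Q x) y = modInner x (Q y)) ∧
      (∀ k, modInner (Q (stdVec A k)) (Q (stdVec A k))
        = (((n : ℝ) / (d : ℝ) : ℝ) : ℂ) • (1 : A)) ∧
      ‖∑ k, modInner (P (stdVec A k) - Q (stdVec A k)) (P (stdVec A k) - Q (stdVec A k))‖
        ≤ 4 * f := by
  obtain ⟨ω, hωP, hpars, hωω, hωf⟩ := hω
  have hpol : ∀ x y, P x = x → P y = y →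
      modInner x y = ∑ k, modInner x (ω k) * modInner (ω k) y := fun x y hx hy =>
    modInner_eq_sum_of_parseval (LinearMap.eqLocus P LinearMap.id) ω hpars hx hy
  have hidemQ := gramMap_gramMap ω fun k i => hpol _ _ (hωP k) (hωP i)
  have hτ : ∀ k j, P (stdVec A k) j = modInner (P (stdVec A k)) (P (stdVec A j)) := fun k j => by
    rw [← hadj, hidem, modInner_stdVec_right]
  have hfix : ∀ k, P (P (stdVec A k) - ω k) = P (stdVec A k) - ω k := fun k => by
    rw [map_sub, hidem, hωP]
  refine ⟨gramMap ω, hidemQ, modInner_gramMap ω, fun k => ?_, ?_⟩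
  · rw [← modInner_gramMap, hidemQ, modInner_stdVec_right, gramMap_stdVec, hωω]
  have hle := sum_modInner_sub_gram_le (fun k => P (stdVec A k)) ω
    (fun j => by
      simp only [hadj _ (P (stdVec A j) - ω j), hfix, modInner_stdVec_left, star_star]
      exact Finset.sum_congr rfl fun _ _ => mul_comm _ _)
    (fun k => (hpars _ (hfix k)).symm)
  simp only [← hτ, ← gramMap_stdVec] at hle
  have hnonneg : 0 ≤ ∑ k, modInner (P (stdVec A k) - gramMap ω (stdVec A k))
      (P (stdVec A k) - gramMap ω (stdVec A k)) :=
    Finset.sum_nonneg fun k _ => Finset.sum_nonneg fun j _ => mul_star_self_nonneg _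
  calc _ ≤ _ := CStarAlgebra.norm_le_norm_of_nonneg_of_le hnonneg hle
    _ = ‖(4 : ℝ) • ∑ k, modInner (P (stdVec A k) - ω k) (P (stdVec A k) - ω k)‖ := by
      rw [Algebra.smul_def, map_ofNat]
    _ ≤ 4 * f := by
      rw [norm_smul, Real.norm_of_nonneg (by norm_num)]
      gcongr
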